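/- Let A ∈ GL(2,ℤ) be an Anosov matrix with R(A) = ∅, let M₀ ∈ GL(2,ℤ) be a primitive root of A (i.e. C(A) = {± M₀^j : j ∈ ℤ}), and suppose A = −M₀^ℓ for some integer ℓ ≥ 1. Let H = (ℤ × ℤ)/((I − A)(ℤ × ℤ)), and note that M₀ induces an automorphism of H (since M₀ commutes with A) whose (2ℓ)-th power is the identity. Then Out(E_A) is isomorphic to the semidirect product H ⋊ ℤ/(2ℓ), where the generator of ℤ/(2ℓ) acts on H by the automorphism induced by M₀. -/

import Mathlib

open Matrix SemidirectProduct Multiplicative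

abbrev GL2Z := GL (Fin 2) ℤ

/-- A matrix in `GL(2,ℤ)` is exceptional if `det = 1` and `|tr| ≤ 2`, or `det = -1` and `tr = 0`. -/
def IsExceptional (A : GL2Z) : Prop :=
  ((A : Matrix (Fin 2) (Fin 2) ℤ).det = 1 ∧ |(A : Matrix (Fin 2) (Fin 2) ℤ).trace| ≤ 2) ∨
    ((A : Matrix (Fin 2) (Fin 2) ℤ).det = -1 ∧ (A : Matrix (Fin 2) (Fin 2) ℤ).trace = 0)

/-- Anosov = not exceptional. -/
def IsAnosov (A : GL2Z) : Prop := ¬ IsExceptional A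

/-- The linear action of a 2×2 integer matrix on `ℤ × ℤ`. -/
def mulVec2 (M : Matrix (Fin 2) (Fin 2) ℤ) (p : ℤ × ℤ) : ℤ × ℤ :=
  (M 0 0 * p.1 + M 0 1 * p.2, M 1 0 * p.1 + M 1 1 * p.2)

lemma mulVec2_one (p : ℤ × ℤ) : mulVec2 1 p = p := by
  simp [mulVec2, Matrix.one_apply]

lemma mulVec2_mul (M N : Matrix (Fin 2) (Fin 2) ℤ) (p : ℤ × ℤ) :
    mulVec2 (M * N) p = mulVec2 M (mulVec2 N p) := by
  apply Prod.ext <;>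
    simp only [mulVec2, Matrix.mul_apply, Fin.sum_univ_two] <;> ring

/-- `mulVec2 M` as an additive monoid homomorphism. -/
def mulVec2Hom (M : Matrix (Fin 2) (Fin 2) ℤ) : (ℤ × ℤ) →+ (ℤ × ℤ) where
  toFun := mulVec2 M
  map_zero' := by simp [mulVec2]
  map_add' p q := by
    apply Prod.ext <;> simp only [mulVec2, Prod.fst_add, Prod.snd_add] <;> ring

/-- The additive automorphism of `ℤ × ℤ` given by an element of `GL(2,ℤ)`. -/
def glAddAut (A : GL2Z) : AddAut (ℤ × ℤ) where
  toFun := mulVec2 (A : Matrix (Fin 2) (Fin 2) ℤ)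
  invFun := mulVec2 ((A⁻¹ : GL2Z) : Matrix (Fin 2) (Fin 2) ℤ)
  left_inv p := by
    rw [← mulVec2_mul]
    rw [show ((A⁻¹ : GL2Z) : Matrix (Fin 2) (Fin 2) ℤ) * (A : Matrix (Fin 2) (Fin 2) ℤ) = 1 from
      A.inv_mul]
    exact mulVec2_one p
  right_inv p := by
    rw [← mulVec2_mul]
    rw [show (A : Matrix (Fin 2) (Fin 2) ℤ) * ((A⁻¹ : GL2Z) : Matrix (Fin 2) (Fin 2) ℤ) = 1 from
      A.mul_inv]
    exact mulVec2_one p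
  map_add' := (mulVec2Hom (A : Matrix (Fin 2) (Fin 2) ℤ)).map_add

/-- The multiplicative automorphism of `Multiplicative (ℤ × ℤ)` given by an element of
`GL(2,ℤ)`. -/
def glMulAut (A : GL2Z) : MulAut (Multiplicative (ℤ × ℤ)) :=
  AddEquiv.toMultiplicative (glAddAut A)

/-- The action of `ℤ` on `ℤ × ℤ` in which `1` acts by the matrix `A`. -/
def EAphi (A : GL2Z) : Multiplicative ℤ →* MulAut (Multiplicative (ℤ × ℤ)) :=
  zpowersHom _ (glMulAut A)

/-- `E_A = (ℤ × ℤ) ⋊ ℤ`, where `1 : ℤ` acts by the matrix `A`. -/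
abbrev EA (A : GL2Z) : Type :=
  Multiplicative (ℤ × ℤ) ⋊[EAphi A] Multiplicative ℤ

/-- The canonical subgroup `ℤ × ℤ` of `E_A`. -/
def EAsub (A : GL2Z) : Subgroup (EA A) :=
  (SemidirectProduct.inl : Multiplicative (ℤ × ℤ) →* EA A).range

/-- The inner automorphisms form a normal subgroup of `Aut(G)`. -/
instance innConjNormal (G : Type*) [Group G] :
    ((MulAut.conj : G →* MulAut G).range).Normal := by
  constructor
  intro x hx φ
  obtain ⟨g, rfl⟩ := hx
  refine ⟨φ g, ?_⟩
  ext h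
  simp [MulAut.conj, mul_assoc]

/-- The outer automorphism group `Out(G) = Aut(G)/Inn(G)`. -/
abbrev OutG (G : Type*) [Group G] : Type _ :=
  MulAut G ⧸ (MulAut.conj : G →* MulAut G).range

/-- The subgroup `(I - A)(ℤ × ℤ)` of `ℤ × ℤ`. -/
def subIA (A : GL2Z) : AddSubgroup (ℤ × ℤ) :=
  (mulVec2Hom (1 - (A : Matrix (Fin 2) (Fin 2) ℤ))).range

/-- `H = (ℤ × ℤ)/((I - A)(ℤ × ℤ))`. -/
abbrev HGrp (A : GL2Z) : Type _ := (ℤ × ℤ) ⧸ subIA A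

/-! ### Matrices as automorphisms of `ℤ × ℤ` -/

lemma mulVec2_injective : Function.Injective mulVec2 := by
  intro M N h
  have h₁ := congrFun h (1, 0)
  have h₂ := congrFun h (0, 1)
  simp only [mulVec2, Prod.mk.injEq, mul_one, mul_zero, add_zero, zero_add] at h₁ h₂
  ext i j
  fin_cases i <;> fin_cases j <;> simp [h₁, h₂]

/-- The matrix of an additive endomorphism of `ℤ × ℤ`. -/
def endMatrix (f : (ℤ × ℤ) →+ (ℤ × ℤ)) : Matrix (Fin 2) (Fin 2) ℤ :=
  !![(f (1, 0)).1, (f (0, 1)).1; (f (1, 0)).2, (f (0, 1)).2]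

lemma mulVec2_endMatrix (f : (ℤ × ℤ) →+ (ℤ × ℤ)) (p : ℤ × ℤ) :
    mulVec2 (endMatrix f) p = f p := by
  have hp : p = p.1 • ((1, 0) : ℤ × ℤ) + p.2 • ((0, 1) : ℤ × ℤ) := by
    ext <;> simp
  conv_rhs => rw [hp, map_add, map_zsmul, map_zsmul]
  ext <;> simp [mulVec2, endMatrix, mul_comm]

/-- `glMulAut` as a homomorphism. -/
def glMulAutHom : GL2Z →* MulAut (Multiplicative (ℤ × ℤ)) where
  toFun := glMulAut
  map_one' := MulEquiv.ext fun x => mulVec2_one x.toAdd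
  map_mul' _ _ := MulEquiv.ext fun x => mulVec2_mul _ _ x.toAdd

lemma glMulAutHom_apply (A : GL2Z) (x : Multiplicative (ℤ × ℤ)) :
    glMulAutHom A x = ofAdd (mulVec2 (A : Matrix (Fin 2) (Fin 2) ℤ) x.toAdd) := rfl

lemma glMulAutHom_injective : Function.Injective glMulAutHom := by
  intro A B h
  apply Units.ext
  apply mulVec2_injective
  funext p
  exact DFunLike.congr_fun h (ofAdd p)

lemma glMulAutHom_surjective : Function.Surjective glMulAutHom := by
  intro b
  let f : (ℤ × ℤ) →+ (ℤ × ℤ) := MonoidHom.toAdditive b.toMonoidHom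
  let g : (ℤ × ℤ) →+ (ℤ × ℤ) := MonoidHom.toAdditive b.symm.toMonoidHom
  have hfg : ∀ p, f (g p) = p := fun p => b.apply_symm_apply (ofAdd p)
  have hgf : ∀ p, g (f p) = p := fun p => b.symm_apply_apply (ofAdd p)
  refine ⟨⟨endMatrix f, endMatrix g, ?_, ?_⟩, ?_⟩
  · apply mulVec2_injective
    funext p
    rw [mulVec2_mul, mulVec2_endMatrix, mulVec2_endMatrix, mulVec2_one, hfg]
  · apply mulVec2_injective
    funext p
    rw [mulVec2_mul, mulVec2_endMatrix, mulVec2_endMatrix, mulVec2_one, hgf]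
  · exact MulEquiv.ext fun x => mulVec2_endMatrix f x.toAdd

lemma EAphi_apply (A : GL2Z) (n : Multiplicative ℤ) :
    EAphi A n = glMulAutHom (A ^ n.toAdd) := by
  rw [map_zpow]
  rfl

/-! ### Anosov matrices -/

lemma trace_pow_add_two {M : Matrix (Fin 2) (Fin 2) ℤ} (hM : M.det = 1) (n : ℕ) :
    (M ^ (n + 2)).trace = M.trace * (M ^ (n + 1)).trace - (M ^ n).trace := by
  have hsq : M ^ 2 = M.trace • M - 1 := by
    rw [det_fin_two] at hM
    ext i j
    fin_cases i <;> fin_cases j <;>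
      simp [pow_two, mul_apply, Fin.sum_univ_two, trace_fin_two, -zsmul_eq_mul] <;> linarith
  rw [pow_add, hsq, mul_sub, mul_one, mul_smul_comm, ← pow_succ, trace_sub, trace_smul,
    smul_eq_mul]

lemma three_le_abs_trace_pow {M : Matrix (Fin 2) (Fin 2) ℤ} (hM : M.det = 1)
    (ht : 3 ≤ |M.trace|) (n : ℕ) :
    |(M ^ n).trace| ≤ |(M ^ (n + 1)).trace| ∧ 3 ≤ |(M ^ (n + 1)).trace| := by
  induction n with
  | zero =>
    simp only [pow_zero, zero_add, pow_one, trace_one, Fintype.card_fin]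
    exact ⟨by norm_num; linarith, ht⟩
  | succ n ih =>
    have h : |M.trace| * |(M ^ (n + 1)).trace| - |(M ^ n).trace| ≤ |(M ^ (n + 2)).trace| := by
      rw [trace_pow_add_two hM, ← abs_mul]
      exact abs_sub_abs_le_abs_sub _ _
    have h' := mul_le_mul_of_nonneg_right ht (abs_nonneg (M ^ (n + 1)).trace)
    change _ ≤ |(M ^ (n + 2)).trace| ∧ 3 ≤ |(M ^ (n + 2)).trace|
    constructor <;> linarith [ih.1, ih.2]

lemma pow_ne_one_of_det_one {M : Matrix (Fin 2) (Fin 2) ℤ} (hM : M.det = 1)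
    (ht : 3 ≤ |M.trace|) {n : ℕ} (hn : n ≠ 0) : M ^ n ≠ 1 := by
  obtain ⟨k, rfl⟩ := Nat.exists_eq_succ_of_ne_zero hn
  intro h
  have := (three_le_abs_trace_pow hM ht k).2
  rw [← Nat.succ_eq_add_one, h] at this
  simp at this

lemma det_eq_one_or (A : GL2Z) :
    (A : Matrix (Fin 2) (Fin 2) ℤ).det = 1 ∨ (A : Matrix (Fin 2) (Fin 2) ℤ).det = -1 :=
  Int.isUnit_iff.mp ((Matrix.isUnit_iff_isUnit_det _).mp A.isUnit)

lemma IsAnosov.pow_ne_one {A : GL2Z} (hA : IsAnosov A) {n : ℕ} (hn : n ≠ 0) : A ^ n ≠ 1 := by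
  intro h
  have h' : (A : Matrix (Fin 2) (Fin 2) ℤ) ^ n = 1 := by
    rw [← Units.val_pow_eq_pow_val, h, Units.val_one]
  unfold IsAnosov IsExceptional at hA
  push Not at hA
  rcases det_eq_one_or A with hd | hd
  · exact pow_ne_one_of_det_one hd (by have := hA.1 hd; omega) hn h'
  · have ht := hA.2 hd
    refine pow_ne_one_of_det_one (M := (A : Matrix (Fin 2) (Fin 2) ℤ) ^ 2) ?_ ?_ hn ?_
    · rw [det_pow, hd]; norm_num
    · have : ((A : Matrix (Fin 2) (Fin 2) ℤ) ^ 2).trace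
          = (A : Matrix (Fin 2) (Fin 2) ℤ).trace ^ 2 + 2 := by
        rw [det_fin_two] at hd
        simp [pow_two, mul_apply, Fin.sum_univ_two, trace_fin_two]
        linarith
      rw [this]
      have : 0 < (A : Matrix (Fin 2) (Fin 2) ℤ).trace ^ 2 := by positivity
      exact le_trans (by linarith) (le_abs_self _)
    · rw [← pow_mul, mul_comm, pow_mul, h', one_pow]

lemma IsAnosov.zpow_eq_one_iff {A : GL2Z} (hA : IsAnosov A) {n : ℤ} : A ^ n = 1 ↔ n = 0 := by
  refine ⟨fun h => ?_, fun h => by simp [h]⟩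
  by_contra hn
  refine hA.pow_ne_one (Int.natAbs_ne_zero.mpr hn) ?_
  rcases Int.natAbs_eq n with h' | h' <;> rw [h'] at h <;> simpa using h

lemma IsAnosov.det_one_sub_ne_zero {A : GL2Z} (hA : IsAnosov A) :
    (1 - (A : Matrix (Fin 2) (Fin 2) ℤ)).det ≠ 0 := by
  intro h
  apply hA
  have : (1 - (A : Matrix (Fin 2) (Fin 2) ℤ)).det
      = 1 - (A : Matrix (Fin 2) (Fin 2) ℤ).trace + (A : Matrix (Fin 2) (Fin 2) ℤ).det := by
    simp [det_fin_two, trace_fin_two]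
    ring
  rw [this] at h
  rcases det_eq_one_or A with hd | hd
  · left
    have : (A : Matrix (Fin 2) (Fin 2) ℤ).trace = 2 := by linarith
    exact ⟨hd, by rw [this]; norm_num⟩
  · exact Or.inr ⟨hd, by linarith⟩

lemma mulVec2_smul_one (c : ℤ) (p : ℤ × ℤ) :
    mulVec2 (c • (1 : Matrix (Fin 2) (Fin 2) ℤ)) p = c • p := by
  ext <;> simp [mulVec2]

lemma det_smul_mem_subIA (A : GL2Z) (p : ℤ × ℤ) :
    (1 - (A : Matrix (Fin 2) (Fin 2) ℤ)).det • p ∈ subIA A := by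
  refine ⟨mulVec2 (adjugate (1 - (A : Matrix (Fin 2) (Fin 2) ℤ))) p, ?_⟩
  change mulVec2 _ _ = _
  rw [← mulVec2_mul, mul_adjugate, mulVec2_smul_one]

lemma mulVec2_one_sub (M : Matrix (Fin 2) (Fin 2) ℤ) (p : ℤ × ℤ) :
    mulVec2 (1 - M) p = p - mulVec2 M p := by
  ext <;> simp [mulVec2] <;> ring

lemma mem_subIA_iff {A : GL2Z} {p : ℤ × ℤ} :
    p ∈ subIA A ↔ ∃ u : Multiplicative (ℤ × ℤ), ofAdd p = u * (glMulAutHom A u)⁻¹ := by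
  constructor
  · rintro ⟨u, rfl⟩
    refine ⟨ofAdd u, ?_⟩
    change ofAdd (mulVec2 _ u) = _
    rw [mulVec2_one_sub, sub_eq_add_neg]
    rfl
  · rintro ⟨u, hu⟩
    refine ⟨u.toAdd, ?_⟩
    change mulVec2 _ _ = _
    rw [mulVec2_one_sub, sub_eq_add_neg]
    exact (congrArg toAdd hu).symm

/-! ### Automorphisms of a semidirect product with `ℤ` -/

section Extension

variable {N : Type*} [CommGroup N] {φ : Multiplicative ℤ →* MulAut N}

lemma conj_inl (y : N ⋊[φ] Multiplicative ℤ) (x : N) :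
    y * inl x * y⁻¹ = inl (φ y.right x) := by
  ext <;> simp [mul_comm]

lemma conj_inr (y : N ⋊[φ] Multiplicative ℤ) (n : Multiplicative ℤ) :
    y * inr n * y⁻¹ = inl (y.left * (φ n y.left)⁻¹) * inr n := by
  ext
  · simp [mul_comm y.right n]
  · simp [mul_comm y.right n]

/-- The endomorphism of `N ⋊ ℤ` that restricts to `b` on `N` and multiplies the generator of `ℤ`
by `v`. -/
def extHom (v : N) (b : MulAut N) (hb : ∀ n, Commute b (φ n)) :
    N ⋊[φ] Multiplicative ℤ →* N ⋊[φ] Multiplicative ℤ :=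
  SemidirectProduct.lift (inl.comp b.toMonoidHom)
    (zpowersHom _ (inl v * inr (ofAdd 1))) (by
      intro g
      have hg : (zpowersHom (N ⋊[φ] Multiplicative ℤ) (inl v * inr (ofAdd 1)) g).right = g := by
        change (rightHom.comp (zpowersHom (N ⋊[φ] Multiplicative ℤ) (inl v * inr (ofAdd 1)))) g
          = MonoidHom.id _ g
        congr 1
        ext
        simp
      ext1 x
      change inl (b (φ g x)) = _ * inl (b x) * _⁻¹
      rw [conj_inl, hg]
      exact congrArg inl (DFunLike.congr_fun (hb g) x))

lemma extHom_inl (v : N) (b : MulAut N) (hb : ∀ n, Commute b (φ n)) (x : N) :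
    extHom v b hb (inl x) = inl (b x) := by
  simp [extHom]

lemma extHom_inr (v : N) (b : MulAut N) (hb : ∀ n, Commute b (φ n)) :
    extHom v b hb (inr (ofAdd 1)) = inl v * inr (ofAdd 1) := by
  simp [extHom]

lemma hom_ext_generators {G : Type*} [Group G] {f g : N ⋊[φ] Multiplicative ℤ →* G}
    (h₁ : ∀ x, f (inl x) = g (inl x)) (h₂ : f (inr (ofAdd 1)) = g (inr (ofAdd 1))) : f = g := by
  apply SemidirectProduct.hom_ext
  · exact MonoidHom.ext h₁
  · exact MonoidHom.ext_mint h₂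

variable {χ : Multiplicative ℤ →* MulAut N}

/-- If `χ` commutes with `φ`, then `N ⋊[χ] ℤ` acts on `N ⋊[φ] ℤ`. -/
def extEnd (h : ∀ m n, Commute (χ m) (φ n)) :
    N ⋊[χ] Multiplicative ℤ →* Monoid.End (N ⋊[φ] Multiplicative ℤ) where
  toFun g := extHom g.left (χ g.right) (h g.right)
  map_one' := by
    apply hom_ext_generators
    · intro x
      rw [extHom_inl]
      simp only [one_right, map_one]
      rfl
    · rw [extHom_inr, one_left, map_one, one_mul]
      rfl
  map_mul' g k := by
    apply hom_ext_generators
    · intro x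
      change _ = extHom _ _ (h _) (extHom _ _ (h _) _)
      simp only [extHom_inl]
      simp
    · change _ = extHom _ _ (h _) (extHom _ _ (h _) _)
      simp only [extHom_inr, map_mul, extHom_inl]
      rw [← mul_assoc, ← map_mul, mul_comm (χ _ _)]
      simp

/-- If `χ` commutes with `φ`, then `N ⋊[χ] ℤ` acts on `N ⋊[φ] ℤ` by automorphisms. -/
def extAut (h : ∀ m n, Commute (χ m) (φ n)) :
    N ⋊[χ] Multiplicative ℤ →* MulAut (N ⋊[φ] Multiplicative ℤ) where
  toFun g := MonoidHom.toMulEquiv (extEnd h g) (extEnd h g⁻¹)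
    (by change extEnd h g⁻¹ * extEnd h g = 1; rw [← map_mul, inv_mul_cancel, map_one])
    (by change extEnd h g * extEnd h g⁻¹ = 1; rw [← map_mul, mul_inv_cancel, map_one])
  map_one' := MulEquiv.ext fun x => DFunLike.congr_fun (map_one (extEnd h)) x
  map_mul' g k := MulEquiv.ext fun x => DFunLike.congr_fun (map_mul (extEnd h) g k) x

lemma extAut_inl (h : ∀ m n, Commute (χ m) (φ n)) (g : N ⋊[χ] Multiplicative ℤ) (x : N) :
    extAut h g (inl x) = inl (χ g.right x) :=
  extHom_inl _ _ (h _) x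

lemma extAut_inr (h : ∀ m n, Commute (χ m) (φ n)) (g : N ⋊[χ] Multiplicative ℤ) :
    extAut h g (inr (ofAdd 1)) = inl g.left * inr (ofAdd 1) :=
  extHom_inr _ _ (h _)

lemma mulAut_ext_generators {f g : MulAut (N ⋊[φ] Multiplicative ℤ)}
    (h₁ : ∀ x, f (inl x) = g (inl x)) (h₂ : f (inr (ofAdd 1)) = g (inr (ofAdd 1))) : f = g :=
  MulEquiv.toMonoidHom_injective (hom_ext_generators h₁ h₂)

lemma extAut_mem_range_conj_iff (h : ∀ m n, Commute (χ m) (φ n)) (g : N ⋊[χ] Multiplicative ℤ) :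
    extAut h g ∈ (MulAut.conj : _ →* MulAut (N ⋊[φ] Multiplicative ℤ)).range ↔
      (∃ u, g.left = u * (φ (ofAdd 1) u)⁻¹) ∧ ∃ m, χ g.right = φ m := by
  constructor
  · rintro ⟨y, hy⟩
    refine ⟨⟨y.left, ?_⟩, y.right, ?_⟩
    · have := DFunLike.congr_fun hy (inr (ofAdd 1))
      rw [extAut_inr, MulAut.conj_apply, conj_inr] at this
      exact (inl_injective (mul_right_cancel this)).symm
    · ext x
      have := DFunLike.congr_fun hy (inl x)
      rw [extAut_inl, MulAut.conj_apply, conj_inl] at this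
      exact (inl_injective this).symm
  · rintro ⟨⟨u, hu⟩, m, hm⟩
    refine ⟨⟨u, m⟩, mulAut_ext_generators ?_ ?_⟩
    · intro x
      rw [extAut_inl, MulAut.conj_apply, conj_inl, hm]
    · rw [extAut_inr, MulAut.conj_apply, conj_inr, hu]

/-- Any automorphism of `N ⋊ ℤ` preserving `N` is determined by an automorphism `b` of `N` and
the image of the generator of `ℤ`; that image projects to a generator of `ℤ`. -/
lemma exists_restriction (f : MulAut (N ⋊[φ] Multiplicative ℤ))
    (hf : ∀ x, (f (inl x)).right = 1) (hf' : ∀ x, (f⁻¹ (inl x)).right = 1) :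
    ∃ b : MulAut N, (∀ x, f (inl x) = inl (b x)) ∧
      (∀ x, b (φ (ofAdd 1) x) = φ (f (inr (ofAdd 1))).right (b x)) ∧
      ((f (inr (ofAdd 1))).right = ofAdd 1 ∨ (f (inr (ofAdd 1))).right = ofAdd (-1)) := by
  have eq_inl : ∀ y : N ⋊[φ] Multiplicative ℤ, y.right = 1 → y = inl y.left := by
    intro y hy
    ext <;> simp [hy]
  have h₁ : ∀ x, f (inl x) = inl (f (inl x)).left := fun x => eq_inl _ (hf x)
  have h₂ : ∀ x, f⁻¹ (inl x) = inl (f⁻¹ (inl x)).left := fun x => eq_inl _ (hf' x)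
  let b : MulAut N :=
    { toFun := fun x => (f (inl x)).left
      invFun := fun x => (f⁻¹ (inl x)).left
      left_inv := fun x => by
        apply inl_injective (φ := φ)
        rw [← h₂, ← h₁, MulAut.inv_apply_self]
      right_inv := fun x => by
        apply inl_injective (φ := φ)
        rw [← h₁, ← h₂, MulAut.apply_inv_self]
      map_mul' := fun x y => by
        apply inl_injective (φ := φ)
        rw [map_mul inl x y, map_mul f, mul_left, hf, map_one, MulAut.one_apply] }
  have hb : ∀ x, f (inl x) = inl (b x) := h₁
  refine ⟨b, hb, ?_, ?_⟩
  · intro x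
    apply inl_injective (φ := φ)
    rw [← hb, ← conj_inl, inl_aut, map_mul, map_mul, map_inv, map_inv, hb]
  · have key : ∀ y : N ⋊[φ] Multiplicative ℤ,
        (f y).right = (f (inr (ofAdd 1))).right ^ y.right.toAdd := by
      intro y
      have hy : y = inl y.left * inr (ofAdd 1) ^ y.right.toAdd := by
        rw [← map_zpow, ← ofAdd_zsmul]
        simp
      conv_lhs => rw [hy, map_mul, map_zpow]
      rw [mul_right, hf, one_mul]
      exact map_zpow rightHom _ _
    have := key (f⁻¹ (inr (ofAdd 1)))
    rw [MulAut.apply_inv_self, right_inr] at this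
    have h := congrArg toAdd this
    rw [toAdd_zpow, toAdd_ofAdd, smul_eq_mul] at h
    rcases Int.eq_one_or_neg_one_of_mul_eq_one' h.symm with ⟨-, h'⟩ | ⟨-, h'⟩
    · exact Or.inl (toAdd.injective h')
    · exact Or.inr (toAdd.injective h')

end Extension

/-! ### Automorphisms of `E_A` -/

lemma right_apply_inl {A : GL2Z} (hA : IsAnosov A) (f : MulAut (EA A))
    (x : Multiplicative (ℤ × ℤ)) : (f (inl x)).right = 1 := by
  let r : (ℤ × ℤ) →+ ℤ := MonoidHom.toAdditive ((rightHom.comp f.toMonoidHom).comp inl)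
  have hr : ∀ p ∈ subIA A, r p = 0 := by
    intro p hp
    obtain ⟨u, hu⟩ := mem_subIA_iff.mp hp
    have h₁ : glMulAutHom A u = EAphi A (ofAdd 1) u := by
      rw [EAphi_apply]
      simp
    have h₂ : rightHom (f (inl (ofAdd p))) = 1 := by
      rw [hu, h₁, map_mul, map_inv, inl_aut]
      simp only [map_mul, map_inv]
      simp
    exact congrArg toAdd h₂
  have h := hr _ (det_smul_mem_subIA A x.toAdd)
  rw [map_zsmul, smul_eq_mul] at h
  exact toAdd.injective ((mul_eq_zero.mp h).resolve_left hA.det_one_sub_ne_zero)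

lemma exists_commuting_matrix {A : GL2Z} (hA : IsAnosov A)
    (hR : {B : GL2Z | B * A * B⁻¹ = A⁻¹} = ∅) (f : MulAut (EA A)) :
    ∃ (B : GL2Z) (v : Multiplicative (ℤ × ℤ)), B * A * B⁻¹ = A ∧
      (∀ x, f (inl x) = inl (glMulAutHom B x)) ∧
      f (inr (ofAdd 1)) = inl v * inr (ofAdd 1) := by
  obtain ⟨b, hb, hcomm, hε⟩ := exists_restriction f (right_apply_inl hA f) (right_apply_inl hA f⁻¹)
  obtain ⟨B, rfl⟩ := glMulAutHom_surjective b
  have hBA : B * A = A ^ ((f (inr (ofAdd 1))).right).toAdd * B := by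
    apply glMulAutHom_injective
    ext1 x
    have := hcomm x
    rw [EAphi_apply, EAphi_apply, toAdd_ofAdd, zpow_one] at this
    rw [map_mul, map_mul]
    exact this
  rcases hε with h | h <;> rw [h, toAdd_ofAdd] at hBA
  · refine ⟨B, (f (inr (ofAdd 1))).left, ?_, hb, ?_⟩
    · rw [hBA, zpow_one, mul_inv_cancel_right]
    · ext1
      · simp
      · simp [h]
  · have : B ∈ {B : GL2Z | B * A * B⁻¹ = A⁻¹} := by
      change B * A * B⁻¹ = A⁻¹
      rw [hBA, _root_.zpow_neg_one, mul_inv_cancel_right]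
    rw [hR] at this
    exact this.elim

lemma commute_EAphi {A M : GL2Z} (h : Commute M A) (m n : Multiplicative ℤ) :
    Commute (EAphi M m) (EAphi A n) := by
  rw [EAphi_apply, EAphi_apply]
  exact (h.zpow_zpow _ _).map glMulAutHom

/-- The homomorphism `E_M → Out(E_A)` for a matrix `M` commuting with `A`. -/
def toOut {A M : GL2Z} (h : Commute M A) : EA M →* OutG (EA A) :=
  (QuotientGroup.mk' _).comp (extAut (commute_EAphi h))

lemma toOut_surjective {A M : GL2Z} (h : Commute M A) (hA : IsAnosov A)
    (hR : {B : GL2Z | B * A * B⁻¹ = A⁻¹} = ∅)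
    (hC : ∀ B : GL2Z, B * A * B⁻¹ = A → ∃ k m : ℤ, B = A ^ m * M ^ k) :
    Function.Surjective (toOut h) := by
  intro q
  obtain ⟨f, rfl⟩ := QuotientGroup.mk'_surjective _ q
  obtain ⟨B, v, hB, hf₁, hf₂⟩ := exists_commuting_matrix hA hR f
  obtain ⟨k, m, rfl⟩ := hC B hB
  refine ⟨⟨(EAphi A (ofAdd m))⁻¹ v, ofAdd k⟩, Eq.symm ?_⟩
  have hf : f = MulAut.conj (inr (ofAdd m)) *
      extAut (commute_EAphi h) ⟨(EAphi A (ofAdd m))⁻¹ v, ofAdd k⟩ := by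
    apply mulAut_ext_generators
    · intro x
      rw [hf₁, MulAut.mul_apply, extAut_inl, MulAut.conj_apply, conj_inl, EAphi_apply, EAphi_apply,
        map_mul]
      rfl
    · rw [hf₂, MulAut.mul_apply, extAut_inr, map_mul, MulAut.conj_apply, MulAut.conj_apply,
        conj_inl, conj_inr]
      simp
  change QuotientGroup.mk' _ f = QuotientGroup.mk' _ _
  rw [hf, map_mul]
  apply mul_eq_right.mpr
  exact (QuotientGroup.eq_one_iff _).mpr ⟨_, rfl⟩

lemma mem_ker_toOut_iff {A M : GL2Z} (h : Commute M A) (g : EA M) :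
    g ∈ (toOut h).ker ↔ g.left.toAdd ∈ subIA A ∧ ∃ m : ℤ, M ^ g.right.toAdd = A ^ m := by
  rw [MonoidHom.mem_ker, toOut, MonoidHom.comp_apply, QuotientGroup.mk'_apply,
    QuotientGroup.eq_one_iff, extAut_mem_range_conj_iff, mem_subIA_iff]
  refine and_congr ?_ ?_
  · simp [EAphi_apply]
  · simp only [EAphi_apply, glMulAutHom_injective.eq_iff]
    exact ⟨fun ⟨m, hm⟩ => ⟨m.toAdd, hm⟩, fun ⟨m, hm⟩ => ⟨ofAdd m, hm⟩⟩

/-! ### The quotient `H` -/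

lemma map_subIA {A M : GL2Z} (h : Commute M A) :
    (subIA A).map (glAddAut M).toAddMonoidHom = subIA A := by
  have key : ∀ {M : GL2Z}, Commute M A → ∀ p ∈ subIA A,
      mulVec2 (M : Matrix (Fin 2) (Fin 2) ℤ) p ∈ subIA A := by
    rintro M h _ ⟨u, rfl⟩
    refine ⟨mulVec2 (M : Matrix (Fin 2) (Fin 2) ℤ) u, ?_⟩
    change mulVec2 _ _ = mulVec2 _ (mulVec2 _ _)
    rw [← mulVec2_mul, ← mulVec2_mul, mul_sub, sub_mul, mul_one, one_mul,
      ← Units.val_mul, ← Units.val_mul, h.eq]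
  apply le_antisymm
  · rintro _ ⟨p, hp, rfl⟩
    exact key h p hp
  · intro p hp
    exact ⟨_, key h.inv_left p hp, (glAddAut M).right_inv p⟩

/-- The automorphism of `H` induced by a matrix commuting with `A`. -/
def inducedAut {A M : GL2Z} (h : Commute M A) : MulAut (Multiplicative (HGrp A)) :=
  AddEquiv.toMultiplicative (QuotientAddGroup.congr _ _ (glAddAut M) (map_subIA h))

/-- The projection `ℤ × ℤ → H`, written multiplicatively. -/
def toH (A : GL2Z) : Multiplicative (ℤ × ℤ) →* Multiplicative (HGrp A) :=
  AddMonoidHom.toMultiplicative (QuotientAddGroup.mk' (subIA A))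

lemma toH_surjective (A : GL2Z) : Function.Surjective (toH A) :=
  QuotientAddGroup.mk'_surjective (subIA A)

lemma toH_eq_one_iff {A : GL2Z} {x : Multiplicative (ℤ × ℤ)} :
    toH A x = 1 ↔ x.toAdd ∈ subIA A :=
  QuotientAddGroup.eq_zero_iff x.toAdd

lemma inducedAut_toH {A M : GL2Z} (h : Commute M A) (x : Multiplicative (ℤ × ℤ)) :
    inducedAut h (toH A x) = toH A (glMulAutHom M x) := rfl

lemma toH_glMulAutHom_self (A : GL2Z) (x : Multiplicative (ℤ × ℤ)) :
    toH A (glMulAutHom A x) = toH A x := by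
  rw [eq_comm, ← mul_inv_eq_one, ← map_inv, ← map_mul, toH_eq_one_iff, mem_subIA_iff]
  exact ⟨x, rfl⟩

lemma inducedAut_zpow_toH {A M : GL2Z} (h : Commute M A) (k : ℤ) (x : Multiplicative (ℤ × ℤ)) :
    (inducedAut h ^ k) (toH A x) = toH A (glMulAutHom (M ^ k) x) := by
  induction k generalizing x with
  | zero => simp
  | succ n ih =>
    rw [_root_.zpow_add_one, MulAut.mul_apply, inducedAut_toH, ih, _root_.zpow_add_one, map_mul,
      MulAut.mul_apply]
  | pred n ih =>
    obtain ⟨y, rfl⟩ := (glMulAutHom M).surjective x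
    rw [_root_.zpow_sub_one, MulAut.mul_apply, ← inducedAut_toH h, MulAut.inv_apply_self, ih,
      ← MulAut.mul_apply, ← map_mul, _root_.zpow_sub_one, inv_mul_cancel_right]

lemma inducedAut_zpow_eq_one {A M : GL2Z} (h : Commute M A) {k m : ℤ} (hk : M ^ k = A ^ m) :
    inducedAut h ^ k = 1 := by
  have hA : inducedAut (Commute.refl A) = 1 := by
    ext1 y
    obtain ⟨x, rfl⟩ := toH_surjective A y
    rw [inducedAut_toH, toH_glMulAutHom_self, MulAut.one_apply]
  ext1 y
  obtain ⟨x, rfl⟩ := toH_surjective A y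
  rw [inducedAut_zpow_toH, hk, ← inducedAut_zpow_toH (Commute.refl A), hA, _root_.one_zpow]

/-- The action of `ℤ/n` on a group given by an automorphism `a` with `a ^ n = 1`. -/
def zmodAction {G : Type*} [Group G] (n : ℕ) (a : G) (ha : a ^ (n : ℤ) = 1) :
    Multiplicative (ZMod n) →* G :=
  AddMonoidHom.toMultiplicativeLeft
    (ZMod.lift n ⟨MonoidHom.toAdditiveRight (zpowersHom G a), ha⟩)

lemma zmodAction_intCast {G : Type*} [Group G] (n : ℕ) (a : G) (ha : a ^ (n : ℤ) = 1) (k : ℤ) :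
    zmodAction n a ha (ofAdd (k : ZMod n)) = a ^ k :=
  congrArg Additive.toMul (ZMod.lift_coe n ⟨MonoidHom.toAdditiveRight (zpowersHom G a), ha⟩ k)

/-- The projection `E_M → H ⋊ ℤ/n`. -/
def toHSemidirect {A M : GL2Z} (h : Commute M A) (n : ℕ) (hn : inducedAut h ^ (n : ℤ) = 1) :
    EA M →* Multiplicative (HGrp A) ⋊[zmodAction n (inducedAut h) hn] Multiplicative (ZMod n) :=
  SemidirectProduct.map (toH A) (AddMonoidHom.toMultiplicative (Int.castAddHom (ZMod n))) (by
    intro k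
    refine MonoidHom.ext fun x => ?_
    change toH A (EAphi M k x) = zmodAction n (inducedAut h) hn (ofAdd (k.toAdd : ZMod n)) (toH A x)
    rw [zmodAction_intCast, inducedAut_zpow_toH, EAphi_apply])

lemma toHSemidirect_surjective {A M : GL2Z} (h : Commute M A) (n : ℕ)
    (hn : inducedAut h ^ (n : ℤ) = 1) : Function.Surjective (toHSemidirect h n hn) := by
  rintro ⟨y, c⟩
  obtain ⟨x, rfl⟩ := toH_surjective A y
  obtain ⟨k, hk⟩ := ZMod.intCast_surjective c.toAdd
  exact ⟨⟨x, ofAdd k⟩, SemidirectProduct.ext rfl (toAdd.injective hk)⟩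

lemma mem_ker_toHSemidirect_iff {A M : GL2Z} (h : Commute M A) (n : ℕ)
    (hn : inducedAut h ^ (n : ℤ) = 1) (g : EA M) :
    g ∈ (toHSemidirect h n hn).ker ↔ g.left.toAdd ∈ subIA A ∧ (n : ℤ) ∣ g.right.toAdd := by
  rw [MonoidHom.mem_ker, SemidirectProduct.ext_iff, ← ZMod.intCast_zmod_eq_zero_iff_dvd,
    ← toH_eq_one_iff]
  exact Iff.rfl

/-! ### Powers of the primitive root -/

lemma neg_zpow_two_mul (B : GL2Z) (n : ℤ) : (-B) ^ (2 * n) = B ^ (2 * n) :=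
  Even.neg_zpow (even_two_mul n) B

lemma zpow_eq_zpow_iff_dvd {A M : GL2Z} {ℓ : ℕ} (hℓ : 1 ≤ ℓ) (hA : IsAnosov A)
    (hAM : A = -(M ^ (ℓ : ℤ))) (k : ℤ) :
    (∃ m : ℤ, M ^ k = A ^ m) ↔ ((2 * ℓ : ℕ) : ℤ) ∣ k := by
  have hsq : ∀ n : ℤ, A ^ (2 * n) = M ^ (2 * ℓ * n) := by
    intro n
    rw [hAM, neg_zpow_two_mul, ← _root_.zpow_mul]
    congr 1
    ring
  have hℓ' : (ℓ : ℤ) ≠ 0 := by omega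
  have hM : ∀ n : ℤ, M ^ n = 1 → n = 0 := by
    intro n h
    have : A ^ (2 * n) = 1 := by rw [hsq, mul_comm, _root_.zpow_mul, h, _root_.one_zpow]
    have := hA.zpow_eq_one_iff.mp this
    omega
  constructor
  · rintro ⟨m, hm⟩
    have h₁ : k = ℓ * m := by
      have h := congrArg (· ^ (2 : ℤ)) hm
      simp only [← _root_.zpow_mul] at h
      rw [mul_comm m, hsq, ← mul_inv_eq_one, ← _root_.zpow_neg, ← _root_.zpow_add] at h
      have := hM _ h
      linarith
    rcases Int.even_or_odd' m with ⟨c, rfl | rfl⟩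
    · exact ⟨c, by rw [h₁]; push_cast; ring⟩
    · rw [_root_.zpow_add_one, hsq, h₁] at hm
      conv_rhs at hm => rw [hAM]
      rw [mul_neg, ← _root_.zpow_add] at hm
      have h₂ : (ℓ : ℤ) * (2 * c + 1) = 2 * ℓ * c + ℓ := by ring
      rw [h₂] at hm
      exfalso
      have h₃ : (1 : GL2Z) = -1 := by
        apply mul_left_cancel (a := M ^ (2 * (ℓ : ℤ) * c + ℓ))
        rw [mul_one, mul_neg_one]
        exact hm
      have h₄ : ((1 : GL2Z) : Matrix (Fin 2) (Fin 2) ℤ) 0 0 =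
          ((-1 : GL2Z) : Matrix (Fin 2) (Fin 2) ℤ) 0 0 := by
        rw [← h₃]
      simp at h₄
  · rintro ⟨c, rfl⟩
    exact ⟨2 * c, by rw [hsq]; push_cast; rfl⟩

/-- Let `A` be Anosov with `R(A) = ∅`, `M₀` a primitive root of `A`, and
`A = -M₀ ^ ℓ` with `ℓ ≥ 1`. Then `Out(E_A) ≅ H ⋊ ℤ/2ℓ`, where
`H = (ℤ × ℤ)/((I - A)(ℤ × ℤ))` and the generator of `ℤ/2ℓ` acts on `H` by the automorphism
induced by `M₀`. -/
theorem stmt8 (A M₀ : GL2Z) (ℓ : ℕ) (hℓ : 1 ≤ ℓ) (hA : IsAnosov A)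
    (hR : {B : GL2Z | B * A * B⁻¹ = A⁻¹} = ∅)
    (hC : ∀ B : GL2Z, B * A * B⁻¹ = A ↔ ∃ j : ℤ, B = M₀ ^ j ∨ B = -(M₀ ^ j))
    (hAM : A = -(M₀ ^ (ℓ : ℤ))) :
    ∃ ψ : Multiplicative (ZMod (2 * ℓ)) →* MulAut (Multiplicative (HGrp A)),
      (∀ x : ℤ × ℤ, ψ (Multiplicative.ofAdd 1)
          (Multiplicative.ofAdd (QuotientAddGroup.mk x)) =
        Multiplicative.ofAdd (QuotientAddGroup.mk
          (mulVec2 (M₀ : Matrix (Fin 2) (Fin 2) ℤ) x))) ∧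
      Nonempty ((OutG (EA A)) ≃*
        (Multiplicative (HGrp A) ⋊[ψ] Multiplicative (ZMod (2 * ℓ)))) := by
  have hcomm : Commute M₀ A :=
    mul_inv_eq_iff_eq_mul.mp ((hC M₀).mpr ⟨1, Or.inl (zpow_one M₀).symm⟩)
  have hdvd := zpow_eq_zpow_iff_dvd hℓ hA hAM
  obtain ⟨m, hm⟩ := (hdvd ((2 * ℓ : ℕ) : ℤ)).mpr dvd_rfl
  have hn := inducedAut_zpow_eq_one hcomm hm
  have hgen : ∀ B : GL2Z, B * A * B⁻¹ = A → ∃ k m : ℤ, B = A ^ m * M₀ ^ k := by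
    intro B hB
    obtain ⟨j, rfl | rfl⟩ := (hC B).mp hB
    · exact ⟨j, 0, by simp⟩
    · refine ⟨j - ℓ, 1, ?_⟩
      rw [zpow_one]
      conv_rhs => rw [hAM]
      rw [neg_mul, ← _root_.zpow_add, add_sub_cancel]
  have hker : (toOut hcomm).ker = (toHSemidirect hcomm (2 * ℓ) hn).ker := by
    ext g
    rw [mem_ker_toOut_iff, mem_ker_toHSemidirect_iff, hdvd]
  refine ⟨zmodAction (2 * ℓ) (inducedAut hcomm) hn, fun x => ?_, ⟨?_⟩⟩
  · have h := zmodAction_intCast (2 * ℓ) (inducedAut hcomm) hn 1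
    rw [Int.cast_one, zpow_one] at h
    rw [h]
    rfl
  · exact (QuotientGroup.quotientKerEquivOfSurjective _ (toOut_surjective hcomm hA hR hgen)).symm.trans
      ((QuotientGroup.quotientMulEquivOfEq hker).trans
        (QuotientGroup.quotientKerEquivOfSurjective _ (toHSemidirect_surjective hcomm (2 * ℓ) hn)))
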